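/- Define a family of numbers c indexed by tuples (a_1,…,a_n) of nonnegative integers with Σ a_i = n, satisfying: c_{1,…,1} = n!, and the recurrences 2c_{a_1,…,a_n} = c_{…,a_{k−1}+1,a_k−1,…} + c_{…,a_k−1,a_{k+1}+1,…} for 1<k<n with a_k ≥ 2, 2c_{a} = c_{a_1−1,a_2+1,…} for a_1 ≥ 2, and 2c_{a} = c_{…,a_{n−1}+1,a_n−1} for a_n ≥ 2. Then for the 'boundary' tuples one has c_{n−k,0,…,0,k} = C(n,k) (binomial coefficient), for 0 ≤ k ≤ n. -/

import Mathlib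

/-- Move one unit of the tuple `a` from position `k` to position `j`. -/
def bumpTuple {n : ℕ} (a : Fin n → ℕ) (k j : Fin n) : Fin n → ℕ :=
  Function.update (Function.update a k (a k - 1)) j (Function.update a k (a k - 1) j + 1)

/-- The mixed Eulerian relations for a family indexed by tuples of nonnegative integers
of length `n+1` summing to `n+1`. -/
def SatisfiesEulerianRelations (n : ℕ) (e : (Fin (n + 1) → ℕ) → ℤ) : Prop :=
  e (fun _ => 1) = Nat.factorial (n + 1) ∧
  (∀ a : Fin (n + 1) → ℕ, (∑ i, a i) = n + 1 →
    ∀ (k : ℕ) (hk : 0 < k) (hkn : k < n),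
      2 ≤ a ⟨k, by omega⟩ →
      2 * e a = e (bumpTuple a ⟨k, by omega⟩ ⟨k - 1, by omega⟩) +
        e (bumpTuple a ⟨k, by omega⟩ ⟨k + 1, by omega⟩)) ∧
  (∀ a : Fin (n + 1) → ℕ, (∑ i, a i) = n + 1 → ∀ hn : 1 ≤ n,
    2 ≤ a 0 → 2 * e a = e (bumpTuple a 0 ⟨1, by omega⟩)) ∧
  (∀ a : Fin (n + 1) → ℕ, (∑ i, a i) = n + 1 → ∀ hn : 1 ≤ n,
    2 ≤ a (Fin.last n) → 2 * e a = e (bumpTuple a (Fin.last n) ⟨n - 1, by omega⟩))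

namespace MixedEulerian

lemma bumpTuple_add_single {n : ℕ} (b : Fin n → ℕ) {k j : Fin n} (hkj : j ≠ k) :
    bumpTuple (b + Pi.single k 1) k j = b + Pi.single j 1 := by
  funext i
  by_cases hj : i = j
  · subst hj
    simp [bumpTuple, Function.update_of_ne hkj, Pi.single_eq_of_ne hkj]
  · by_cases hk : i = k
    · subst hk
      simp [bumpTuple, Function.update_of_ne hj, Pi.single_eq_of_ne hj]
    · simp [bumpTuple, hj, hk]

/-- The value of `c` on `b` with one unit added at the `i`-th position, counted from `1`;
positions outside `1, …, n + 1` give `0`. -/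
def shifted {n : ℕ} (c : (Fin (n + 1) → ℕ) → ℤ) (b : Fin (n + 1) → ℕ) (i : ℕ) : ℤ :=
  if h : 0 < i ∧ i ≤ n + 1 then c (b + Pi.single ⟨i - 1, by omega⟩ 1) else 0

/-- The mixed Eulerian recurrences as discrete harmonicity on the support of `b`. -/
def Harmonic {n : ℕ} (c : (Fin (n + 1) → ℕ) → ℤ) : Prop :=
  ∀ b : Fin (n + 1) → ℕ, ∑ i, b i = n → ∀ i : Fin (n + 1), 1 ≤ b i →
    2 * shifted c b (i + 1) = shifted c b i + shifted c b (i + 2)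

lemma shifted_succ {n : ℕ} (c : (Fin (n + 1) → ℕ) → ℤ) (b : Fin (n + 1) → ℕ) {i : ℕ}
    (hi : i < n + 1) : shifted c b (i + 1) = c (b + Pi.single ⟨i, hi⟩ 1) := by
  simp [shifted, Nat.succ_le_of_lt hi]

lemma shifted_zero {n : ℕ} (c : (Fin (n + 1) → ℕ) → ℤ) (b : Fin (n + 1) → ℕ) :
    shifted c b 0 = 0 := by
  simp [shifted]

lemma shifted_of_lt {n : ℕ} (c : (Fin (n + 1) → ℕ) → ℤ) (b : Fin (n + 1) → ℕ) {i : ℕ}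
    (hi : n + 1 < i) : shifted c b i = 0 :=
  dif_neg (by omega)

lemma sum_add_single {n : ℕ} (b : Fin (n + 1) → ℕ) (i : Fin (n + 1)) :
    ∑ j, (b + Pi.single i 1 : Fin (n + 1) → ℕ) j = ∑ j, b j + 1 := by
  simp [Finset.sum_add_distrib]

lemma harmonic_of_relations {n : ℕ} {c : (Fin (n + 1) → ℕ) → ℤ}
    (hc : SatisfiesEulerianRelations n c) : Harmonic c := by
  obtain ⟨-, hmid, hleft, hright⟩ := hc
  rintro b hb ⟨i, hi⟩ hbi
  have hn : 1 ≤ n := hb ▸ hbi.trans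
    (Finset.single_le_sum (fun j _ => Nat.zero_le (b j)) (Finset.mem_univ (⟨i, hi⟩ : Fin (n + 1))))
  have hsum : ∑ j, (b + Pi.single ⟨i, hi⟩ 1 : Fin (n + 1) → ℕ) j = n + 1 := by
    rw [sum_add_single, hb]
  have htwo : 2 ≤ (b + Pi.single ⟨i, hi⟩ 1 : Fin (n + 1) → ℕ) ⟨i, hi⟩ := by
    simp only [Pi.add_apply, Pi.single_eq_same]; omega
  dsimp only
  rw [shifted_succ c b hi]
  rcases Nat.eq_zero_or_pos i with rfl | hpos
  · rw [shifted_zero, zero_add, shifted_succ c b (i := 1) (by omega)]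
    refine (hleft _ hsum hn htwo).trans ?_
    exact congrArg c (bumpTuple_add_single b (by simp [Fin.ext_iff]))
  · obtain ⟨p, rfl⟩ : ∃ p, i = p + 1 := ⟨i - 1, by omega⟩
    rw [shifted_succ c b (i := p) (by omega)]
    rcases (Nat.lt_succ_iff.mp hi).eq_or_lt with rfl | hlt
    · rw [shifted_of_lt c b (by omega), add_zero]
      refine (hright _ hsum hn htwo).trans ?_
      exact congrArg c (bumpTuple_add_single b (by simp [Fin.ext_iff]))
    · rw [shifted_succ c b (i := p + 1 + 1) (by omega)]
      refine (hmid _ hsum (p + 1) hpos hlt htwo).trans ?_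
      exact congrArg₂ (· + ·)
        (congrArg c (bumpTuple_add_single b (by simp [Fin.ext_iff])))
        (congrArg c (bumpTuple_add_single b (by simp [Fin.ext_iff])))

lemma shifted_comp_rev {n : ℕ} (c : (Fin (n + 1) → ℕ) → ℤ) (b : Fin (n + 1) → ℕ) {i j : ℕ}
    (hij : i + j = n + 2) :
    shifted (fun a => c (a ∘ Fin.rev)) b i = shifted c (b ∘ Fin.rev) j := by
  unfold shifted
  by_cases h : 0 < i ∧ i ≤ n + 1
  · rw [dif_pos h, dif_pos (by omega)]
    refine congrArg c (funext fun x => ?_)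
    simp only [Function.comp_apply, Pi.add_apply, Pi.single_apply, Fin.ext_iff, Fin.val_rev]
    congr 1
    exact if_congr (by omega) rfl rfl
  · rw [dif_neg h, dif_neg (by omega)]

lemma Harmonic.comp_rev {n : ℕ} {c : (Fin (n + 1) → ℕ) → ℤ} (hc : Harmonic c) :
    Harmonic (fun a => c (a ∘ Fin.rev)) := by
  intro b hb i hbi
  have hsum : ∑ j, (b ∘ Fin.rev) j = n := by
    exact (Equiv.sum_comp Fin.revPerm b).trans hb
  have h := hc (b ∘ Fin.rev) hsum i.rev (by simpa using hbi)
  have hi := i.isLt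
  have hrev := Fin.val_rev i
  rw [shifted_comp_rev c b (j := i.rev + 1) (by omega),
    shifted_comp_rev c b (j := i.rev + 2) (by omega),
    shifted_comp_rev c b (j := i.rev) (by omega), h, add_comm]

/-- Harmonicity on the first `m` positions makes `shifted c b` linear on `0, …, m + 1`. -/
lemma Harmonic.shifted_eq_mul {n : ℕ} {c : (Fin (n + 1) → ℕ) → ℤ} (hc : Harmonic c)
    {b : Fin (n + 1) → ℕ} (hb : ∑ i, b i = n) {m : ℕ} (hm : m ≤ n)
    (hpos : ∀ i : Fin (n + 1), (i : ℕ) < m → 1 ≤ b i) :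
    ∀ i ≤ m, shifted c b i = i * shifted c b 1 ∧
      shifted c b (i + 1) = (i + 1) * shifted c b 1 := by
  intro i
  induction i with
  | zero => intro _; simp [shifted_zero]
  | succ i ih =>
    intro hi
    obtain ⟨h₁, h₂⟩ := ih (by omega)
    have h := hc b hb ⟨i, by omega⟩ (hpos ⟨i, by omega⟩ (by simpa using hi))
    dsimp only at h
    push_cast
    refine ⟨h₂, ?_⟩
    linear_combination 2 * h₂ - h₁ - h

/-- `m` units at the first position can be spread over the first `m` positions at the cost of
a factor `m!`. -/
lemma Harmonic.factorial_mul {n : ℕ} {c : (Fin (n + 1) → ℕ) → ℤ} (hc : Harmonic c) (m : ℕ) :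
    ∀ M : Fin (n + 1) → ℕ, ∑ i, M i + m = n + 1 →
      (m.factorial : ℤ) * c (M + Pi.single 0 m) =
        c (M + fun i : Fin (n + 1) => if (i : ℕ) < m then 1 else 0) := by
  induction m with
  | zero => intro M _; simp; congr 1
  | succ m ih =>
    intro M hM
    have h := ih (M + Pi.single 0 1) (by rw [sum_add_single]; omega)
    set b : Fin (n + 1) → ℕ := M + fun i : Fin (n + 1) => if (i : ℕ) < m then 1 else 0 with hbdef
    have hbsum : ∑ i, b i = n := by
      have hcard : ∑ i : Fin (n + 1), (if (i : ℕ) < m then 1 else 0) = m := by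
        rw [Fin.sum_univ_eq_sum_range (fun i => if i < m then 1 else 0) (n + 1),
          Finset.sum_ite, Finset.sum_const_zero, Finset.sum_const, add_zero, smul_eq_mul, mul_one,
          show (Finset.range (n + 1)).filter (· < m) = Finset.range m by
            ext; simp only [Finset.mem_filter, Finset.mem_range]; omega, Finset.card_range]
      simp only [hbdef, Pi.add_apply, Finset.sum_add_distrib, hcard]
      omega
    have hlin := (hc.shifted_eq_mul hbsum (m := m) (by omega)
      (fun i hi => by simp [hbdef, hi]) m le_rfl).2
    rw [shifted_succ c b (by omega), shifted_succ c b (i := 0) (by omega)] at hlin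
    have e₁ : M + Pi.single 0 (m + 1) = M + Pi.single 0 1 + Pi.single 0 m := by
      rw [add_assoc, ← Pi.single_add, add_comm 1 m]
    have e₂ : (M + fun i : Fin (n + 1) => if (i : ℕ) < m + 1 then 1 else 0) =
        b + Pi.single ⟨m, by omega⟩ 1 := by
      funext i
      simp only [hbdef, Pi.add_apply, Pi.single_apply, Fin.ext_iff]
      split_ifs <;> omega
    have e₃ : (M + Pi.single 0 1 + fun i : Fin (n + 1) => if (i : ℕ) < m then 1 else 0) =
        b + Pi.single ⟨0, by omega⟩ 1 := add_right_comm _ _ _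
    rw [e₃] at h
    rw [e₁, e₂, hlin, ← h, Nat.factorial_succ]
    push_cast
    ring

end MixedEulerian

/-- If a family `c` indexed by tuples of nonnegative integers of length `m = n+1` summing to
`m` satisfies `c_{1,…,1} = m!` and the mixed Eulerian recurrences, then on the boundary
tuples `(m−k, 0, …, 0, k)` one has `c_{m−k,0,…,0,k} = C(m, k)` for `0 ≤ k ≤ m`. -/
theorem eulerian_boundary_binomial (n : ℕ) (c : (Fin (n + 1) → ℕ) → ℤ)
    (hc : SatisfiesEulerianRelations n c) :
    ∀ k ≤ n + 1,
      c (fun i => (if (i : ℕ) = 0 then n + 1 - k else 0) +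
            (if (i : ℕ) = n then k else 0)) =
        (Nat.choose (n + 1) k : ℤ) := by
  intro k hk
  have hH := MixedEulerian.harmonic_of_relations hc
  have hleft := hH.factorial_mul (n + 1 - k) (Pi.single (Fin.last n) k)
    (by simp only [Finset.sum_pi_single', Finset.mem_univ, if_true]; omega)
  have hright := hH.comp_rev.factorial_mul k (fun i => if k ≤ (i : ℕ) then 1 else 0) (by
    rw [Fin.sum_univ_eq_sum_range (fun i => if k ≤ i then 1 else 0) (n + 1), Finset.sum_ite,
      Finset.sum_const_zero, Finset.sum_const, add_zero, smul_eq_mul, mul_one,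
      show (Finset.range (n + 1)).filter (k ≤ ·) = Finset.Ico k (n + 1) by
        ext; simp only [Finset.mem_filter, Finset.mem_range, Finset.mem_Ico]; omega, Nat.card_Ico]
    omega)
  have e₁ : (fun i : Fin (n + 1) => (if (i : ℕ) = 0 then n + 1 - k else 0) +
      (if (i : ℕ) = n then k else 0)) =
      Pi.single (Fin.last n) k + Pi.single 0 (n + 1 - k) := by
    funext i
    simp only [Pi.add_apply, Pi.single_apply, Fin.ext_iff, Fin.val_last, Fin.val_zero]
    exact add_comm _ _
  have e₂ : ((fun i : Fin (n + 1) => if k ≤ (i : ℕ) then 1 else 0) + Pi.single 0 k) ∘ Fin.rev =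
      Pi.single (Fin.last n) k + fun i : Fin (n + 1) => if (i : ℕ) < n + 1 - k then 1 else 0 := by
    funext i
    have hi := i.isLt
    simp only [Function.comp_apply, Pi.add_apply, Pi.single_apply, Fin.ext_iff, Fin.val_rev,
      Fin.val_last, Fin.val_zero]
    rw [add_comm]
    exact congrArg₂ (· + ·) (if_congr (by omega) rfl rfl) (if_congr (by omega) rfl rfl)
  have e₃ : ((fun i : Fin (n + 1) => if k ≤ (i : ℕ) then 1 else 0) +
      fun i : Fin (n + 1) => if (i : ℕ) < k then 1 else 0) ∘ Fin.rev = fun _ => 1 := by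
    funext i
    simp only [Function.comp_apply, Pi.add_apply]
    split_ifs <;> omega
  rw [e₂, e₃, hc.1, ← hleft, ← e₁, ← Nat.choose_mul_factorial_mul_factorial hk] at hright
  push_cast at hright
  have hne : (k.factorial : ℤ) * ((n + 1 - k).factorial : ℤ) ≠ 0 := by positivity
  apply mul_left_cancel₀ hne
  linear_combination hright
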